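/- There are no Gaussian integers x, y, z with xyz ≠ 0, gcd(x, y, z) a unit, y divisible by 1+i, such that x^4 + 6(1+i)·x^2y^2 + 2i·y^4 = z^2. -/

import Mathlib

open Zsqrtd

namespace GaussDescent

abbrev I : GaussianInt := sqrtd

lemma I_sq : I ^ 2 = -1 := by decide

lemma unit_cases (u : GaussianInt) (hu : IsUnit u) : u = 1 ∨ u = -1 ∨ u = I ∨ u = -I := by
  have h : u.norm.natAbs = 1 := Zsqrtd.norm_eq_one_iff.mpr hu
  have h0 := GaussianInt.norm_nonneg u
  have h1 : u.re * u.re + u.im * u.im = 1 := by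
    have : u.norm = 1 := by omega
    rw [Zsqrtd.norm_def] at this
    linarith
  have hr1 : u.re ≤ 1 := by nlinarith [mul_self_nonneg u.im]
  have hr2 : -1 ≤ u.re := by nlinarith [mul_self_nonneg u.im]
  have hi1 : u.im ≤ 1 := by nlinarith [mul_self_nonneg u.re]
  have hi2 : -1 ≤ u.im := by nlinarith [mul_self_nonneg u.re]
  obtain ⟨a, b⟩ := u
  simp only at *
  interval_cases a <;> interval_cases b <;> simp_all [Zsqrtd.ext_iff]

lemma w_dvd_iff (x : GaussianInt) : (1 + I) ∣ x ↔ (2 : ℤ) ∣ x.re + x.im := by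
  constructor
  · rintro ⟨k, rfl⟩
    exact ⟨k.re, by simp; ring⟩
  · rintro ⟨k, hk⟩
    refine ⟨⟨k, x.im - k⟩, ?_⟩
    ext <;> simp <;> omega

lemma w_prime : Prime (1 + I) := by
  refine ⟨by decide, ?_, ?_⟩
  · intro h
    rcases unit_cases _ h with h | h | h | h <;> exact absurd h (by decide)
  · intro a b h
    simp only [w_dvd_iff] at *
    have h2 : (2:ℤ) ∣ (a.re + a.im) * (b.re + b.im) := by
      have : (a.re + a.im) * (b.re + b.im) = (a * b).re + (a * b).im + 2 * (a.im * b.im) := by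
        simp; ring
      rw [this]
      exact dvd_add h (Dvd.intro _ rfl)
    exact Int.prime_two.dvd_or_dvd h2

/-- Squares of odd Gaussian integers modulo 4. -/
lemma odd_sq (x : GaussianInt) (hx : ¬ (1 + I) ∣ x) :
    ((∃ k, x = 1 + 2 * k) ∧ ∃ k, x ^ 2 = 1 + 4 * k) ∨ (∃ k, x ^ 2 = -1 + 4 * k) := by
  rw [w_dvd_iff] at hx
  obtain ⟨a, b⟩ := x
  simp only at hx
  rcases Int.even_or_odd' a with ⟨c, hc | hc⟩ <;> rcases Int.even_or_odd' b with ⟨d, hd | hd⟩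
  · omega
  · right
    refine ⟨⟨c ^ 2 - d ^ 2 - d, c * b⟩, ?_⟩
    subst hc hd
    ext <;> simp [pow_two] <;> ring
  · left
    refine ⟨⟨⟨c, d⟩, ?_⟩, ⟨⟨c ^ 2 + c - d ^ 2, a * d⟩, ?_⟩⟩
    · subst hc hd
      ext <;> simp [add_comm]
    · subst hc hd
      ext <;> simp [pow_two] <;> ring
  · omega

lemma not_four_dvd (a b : ℤ) (h : ¬ (4 ∣ a ∧ 4 ∣ b)) (k : GaussianInt)
    (hk : (⟨a, b⟩ : GaussianInt) = 4 * k) : False := by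
  apply h
  rw [Zsqrtd.ext_iff] at hk
  simp at hk
  exact ⟨⟨_, hk.1⟩, ⟨_, hk.2⟩⟩

lemma not_two_dvd (a b : ℤ) (h : ¬ (2 ∣ a ∧ 2 ∣ b)) (k : GaussianInt)
    (hk : (⟨a, b⟩ : GaussianInt) = 2 * k) : False := by
  apply h
  rw [Zsqrtd.ext_iff] at hk
  simp at hk
  exact ⟨⟨_, hk.1⟩, ⟨_, hk.2⟩⟩

lemma odd_sq2 (x : GaussianInt) (hx : ¬ (1 + I) ∣ x) : ∃ k, x ^ 2 = 1 + 2 * k := by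
  rcases odd_sq x hx with ⟨_, k, hk⟩ | ⟨k, hk⟩
  · exact ⟨2 * k, by rw [hk]; ring⟩
  · exact ⟨2 * k - 1, by rw [hk]; ring⟩

lemma odd_pow4 (x : GaussianInt) (hx : ¬ (1 + I) ∣ x) : ∃ k, x ^ 4 = 1 + 4 * k := by
  obtain ⟨k, hk⟩ := odd_sq2 x hx
  exact ⟨k + k ^ 2, by rw [show x ^ 4 = (x ^ 2) ^ 2 by ring, hk]; ring⟩

/-- An odd number whose square is 1 mod 4 is 1 mod 2. -/
lemma root_one (c m : GaussianInt) (hc : ¬ (1 + I) ∣ c) (h : c ^ 2 = 1 + 4 * m) :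
    ∃ k, c = 1 + 2 * k := by
  rcases odd_sq c hc with ⟨h1, _⟩ | ⟨k, hk⟩
  · exact h1
  · exfalso
    refine not_four_dvd 2 0 (by decide) (k - m) ?_
    have : (⟨2, 0⟩ : GaussianInt) = 2 := rfl
    rw [this]
    linear_combination hk - h

lemma w_dvd_two : (1 + I) ∣ 2 := ⟨1 - I, by linear_combination I_sq⟩

lemma odd_of_one (c k : GaussianInt) (h : c = 1 + 2 * k) : ¬ (1 + I) ∣ c := by
  intro hd
  apply w_prime.not_isUnit
  apply isUnit_of_dvd_one
  have h1 : c - 2 * k = 1 := by rw [h]; ring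
  have h2 := dvd_sub hd (Dvd.dvd.mul_right w_dvd_two k)
  rwa [h1] at h2

/-- If `u * p` is `1` mod 2 with `p` being `1` mod 2 then the unit `u` is `±1`. -/
lemma unit_pm (u p k l : GaussianInt) (hu : IsUnit u) (hp : p = 1 + 2 * k)
    (h : u * p = 1 + 2 * l) : u = 1 ∨ u = -1 := by
  rcases unit_cases u hu with rfl | rfl | rfl | rfl
  · exact Or.inl rfl
  · exact Or.inr rfl
  · exfalso
    refine not_two_dvd (-1) 1 (by decide) (l - I * k) ?_
    have : (⟨-1, 1⟩ : GaussianInt) = -1 + I := rfl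
    rw [this]
    subst hp
    linear_combination h
  · exfalso
    refine not_two_dvd (-1) (-1) (by decide) (l + I * k) ?_
    have : (⟨-1, -1⟩ : GaussianInt) = -1 - I := by decide
    rw [this]
    subst hp
    linear_combination h

lemma pm_sq (u : GaussianInt) (h : u = 1 ∨ u = -1) : ∃ r, r ^ 2 = u ∧ IsUnit r := by
  rcases h with rfl | rfl
  · exact ⟨1, by ring, isUnit_one⟩
  · exact ⟨I, I_sq, IsUnit.of_mul_eq_one (-I) (by linear_combination -I_sq)⟩

lemma unit_sq (u : GaussianInt) (hu : IsUnit u) : u ^ 2 = 1 ∨ u ^ 2 = -1 := by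
  rcases unit_cases u hu with rfl | rfl | rfl | rfl
  · left; ring
  · left; ring
  · right; exact I_sq
  · right; linear_combination I_sq

lemma isCoprime_w (x : GaussianInt) (h : ¬ (1 + I) ∣ x) : IsCoprime (1 + I) x :=
  (w_prime.irreducible.coprime_iff_not_dvd).mpr h

/-- Coprime factorization of a fourth power, odd normalized factor. -/
lemma factor4 (A B y l : GaussianInt) (hy : y ≠ 0) (hAB : IsCoprime A B) (h : A * B = y ^ 4)
    (hA : A = 1 + 2 * l) :
    ∃ s t u v, (u = 1 ∨ u = -1) ∧ IsUnit v ∧ A = u * s ^ 4 ∧ B = u * t ^ 4 ∧ y = v * (s * t) ∧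
      ¬ (1 + I) ∣ s ∧ IsCoprime s t := by
  obtain ⟨s, u, hs⟩ := exists_associated_pow_of_mul_eq_pow' hAB h
  obtain ⟨t, u', ht⟩ := exists_associated_pow_of_mul_eq_pow' hAB.symm (by rw [mul_comm]; exact h)
  have hso : ¬ (1 + I) ∣ s := by
    intro hd
    apply odd_of_one A l hA
    rw [← hs]
    exact Dvd.dvd.mul_right (dvd_pow hd (by norm_num)) _
  obtain ⟨k, hk⟩ := odd_pow4 s hso
  have hu := unit_pm u (s ^ 4) (2 * k) l u.isUnit (by rw [hk]; ring) (by rw [← hA, ← hs]; ring)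
  have hass : Associated ((s * t) ^ 4) (y ^ 4) :=
    ⟨u * u', by rw [← h, ← hs, ← ht]; push_cast; ring⟩
  have h1 : s * t ∣ y := (IsIntegrallyClosed.pow_dvd_pow_iff (by norm_num)).mp hass.dvd
  have h2 : y ∣ s * t := (IsIntegrallyClosed.pow_dvd_pow_iff (by norm_num)).mp hass.symm.dvd
  obtain ⟨v, hv⟩ := associated_of_dvd_dvd h1 h2
  have hst : s * t ≠ 0 := by
    intro h0; apply hy; rw [← hv, h0, zero_mul]
  have hv4 : (v : GaussianInt) ^ 4 = 1 := by
    rcases unit_sq v v.isUnit with h | h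
    · linear_combination ((v : GaussianInt) ^ 2 + 1) * h
    · linear_combination ((v : GaussianInt) ^ 2 - 1) * h
  have huu : (u : GaussianInt) * u' = 1 := by
    apply mul_left_cancel₀ (pow_ne_zero 4 hst)
    have : (s * t) ^ 4 * ((u : GaussianInt) * u') = y ^ 4 := by rw [← h, ← hs, ← ht]; ring
    rw [this, ← hv, mul_pow, hv4]
  have hu' : (u' : GaussianInt) = u := by
    rcases hu with h | h <;> rw [h] at huu ⊢
    · linear_combination huu
    · linear_combination -huu
  refine ⟨s, t, u, v, hu, v.isUnit, by rw [← hs]; ring, by rw [← ht, hu']; ring,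
    by rw [← hv]; ring, hso, ?_⟩
  have : IsCoprime (s ^ 4) (t ^ 4) := by
    refine IsCoprime.of_isCoprime_of_dvd_left (IsCoprime.of_isCoprime_of_dvd_right hAB ?_) ?_
    · exact ⟨_, ht.symm⟩
    · exact ⟨_, hs.symm⟩
  exact (IsCoprime.pow_iff (by norm_num) (by norm_num)).mp this

lemma coprime_of_add (A B : GaussianInt) (h : IsCoprime (A + B) (A * B)) : IsCoprime A B := by
  have h1 : IsCoprime (A + B) B := h.of_mul_right_right
  have := h1.add_mul_right_left (-1)
  simpa using this

/-- Splitting step shared by both descents, oriented version. -/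
lemma split_aux (A B N D y l D' : GaussianInt) (hD2 : D = 2 * D')
    (hDw : ∀ a, ¬ (1 + I) ∣ a → IsCoprime D a)
    (hy : y ≠ 0) (hsum : A + B = N) (hN : N = 1 + 2 * l) (hD0 : D ≠ 0)
    (hAB : IsCoprime A B) (hB : (1 + I) ∣ B) (hprod : A * B = D * y ^ 4) :
    ∃ s t u v, (u = 1 ∨ u = -1) ∧ IsUnit v ∧ N = u * s ^ 4 + D * (u * t ^ 4) ∧
      y = v * (s * t) ∧ ¬ (1 + I) ∣ s ∧ IsCoprime s t := by
  have hA : ¬ (1 + I) ∣ A := fun h => w_prime.not_isUnit (hAB.isUnit_of_dvd' h hB)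
  obtain ⟨B1, rfl⟩ : D ∣ B := (hDw A hA).dvd_of_dvd_mul_left ⟨_, hprod⟩
  have h1 : A * B1 = y ^ 4 := by
    apply mul_left_cancel₀ hD0
    linear_combination hprod
  obtain ⟨s, t, u, v, hu, hv, hs, ht, hyv, hso, hst⟩ :=
    factor4 A B1 y (l - D' * B1) hy hAB.of_mul_right_right h1
      (by linear_combination hsum + hN - B1 * hD2)
  exact ⟨s, t, u, v, hu, hv, by rw [← hs, ← ht, hsum], hyv, hso, hst⟩

/-- Splitting step shared by both descents. -/
lemma split (A B N D y l D' : GaussianInt) (hD2 : D = 2 * D')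
    (hDw : ∀ a, ¬ (1 + I) ∣ a → IsCoprime D a)
    (hy : y ≠ 0) (hsum : A + B = N) (hN : N = 1 + 2 * l) (hD0 : D ≠ 0)
    (hNy : IsCoprime N y) (hprod : A * B = D * y ^ 4) :
    ∃ s t u v, (u = 1 ∨ u = -1) ∧ IsUnit v ∧ N = u * s ^ 4 + D * (u * t ^ 4) ∧
      y = v * (s * t) ∧ ¬ (1 + I) ∣ s ∧ IsCoprime s t := by
  have hAB : IsCoprime A B := by
    apply coprime_of_add
    rw [hsum, hprod]
    exact (hDw N (odd_of_one N l hN)).symm.mul_right hNy.pow_right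
  have hw : (1 + I) ∣ A * B := by
    rw [hprod, hD2, mul_assoc]
    exact Dvd.dvd.mul_right w_dvd_two _
  rcases w_prime.dvd_or_dvd hw with h | h
  · exact split_aux B A N D y l D' hD2 hDw hy (by rw [add_comm]; exact hsum) hN hD0 hAB.symm h
      (by rw [mul_comm]; exact hprod)
  · exact split_aux A B N D y l D' hD2 hDw hy hsum hN hD0 hAB h hprod

lemma coprime_two (a : GaussianInt) (h : ¬ (1 + I) ∣ a) : IsCoprime 2 a := by
  have h1 := isCoprime_w a h
  refine IsCoprime.of_isCoprime_of_dvd_left (h1.mul_left h1) ?_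
  exact ⟨I, by decide⟩

lemma coprime_two_I (a : GaussianInt) (h : ¬ (1 + I) ∣ a) : IsCoprime (2 * -I) a := by
  have h1 := coprime_two a h
  have h2 : IsUnit (-I) := IsUnit.of_mul_eq_one I (by decide)
  exact (isCoprime_mul_unit_right_left h2 _ _).mpr h1

/-- The core descent: `c² = e⁴ - 2i g⁴` has no solutions with `e` odd and `g ≠ 0`. -/
lemma core (g : GaussianInt) : g ≠ 0 → ∀ e c : GaussianInt, ¬ (1 + I) ∣ e → IsCoprime e g →
    c ^ 2 = e ^ 4 - 2 * I * g ^ 4 → False := by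
  induction g using IsWellFounded.induction (DvdNotUnit (α := GaussianInt)) with
  | ind g ih =>
  intro hg e c he heg h
  obtain ⟨k4, hk4⟩ := odd_pow4 e he
  have hco : ¬ (1 + I) ∣ c := by
    intro hd
    refine odd_of_one (c ^ 2) (2 * k4 - I * g ^ 4) (by rw [h, hk4]; ring) ?_
    exact dvd_pow hd (by norm_num)
  have hge : (1 + I) ∣ g := by
    by_contra hgo
    obtain ⟨m, hm⟩ := odd_pow4 g hgo
    rcases odd_sq c hco with ⟨_, k, hk⟩ | ⟨k, hk⟩
    · refine not_four_dvd 0 (-2) (by decide) (k - k4 + 2 * I * m) ?_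
      have : (⟨0, -2⟩ : GaussianInt) = -2 * I := by decide
      rw [this]
      linear_combination hk - h - hk4 + 2 * I * hm
    · refine not_four_dvd 2 (-2) (by decide) (k - k4 + 2 * I * m) ?_
      have : (⟨2, -2⟩ : GaussianInt) = 2 - 2 * I := by decide
      rw [this]
      linear_combination hk - h - hk4 + 2 * I * hm
  obtain ⟨g1, rfl⟩ := hge
  have hg1 : g1 ≠ 0 := by rintro rfl; simp at hg
  have hw4 : (1 + I) ^ 4 = -4 := by decide
  obtain ⟨k, hk⟩ := root_one c (k4 + 2 * I * g1 ^ 4) hco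
    (by linear_combination h + hk4 - 2 * I * g1 ^ 4 * hw4)
  obtain ⟨l, hl⟩ := odd_sq2 e he
  obtain ⟨s, t, u, v, hu, hv, hN, hy, hso, hst⟩ :=
    split (l - k) (1 + l + k) (e ^ 2) (2 * -I) g1 l (-I) rfl coprime_two_I hg1
      (by linear_combination -hl) hl (by decide) heg.of_mul_right_right.pow_left (by
        apply mul_left_cancel₀ (show (4 : GaussianInt) ≠ 0 by decide)
        have h1 : 4 * ((l - k) * (1 + l + k)) = (e ^ 2 - c) * (e ^ 2 + c) := by
          rw [hl, hk]; ring
        rw [h1]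
        linear_combination -h + 2 * I * g1 ^ 4 * hw4)
  have ht : t ≠ 0 := by rintro rfl; simp at hy; exact hg1 hy
  obtain ⟨r, hr, -⟩ := pm_sq u hu
  have hu2 : u ^ 2 = 1 := by rcases hu with rfl | rfl <;> ring
  refine ih t ⟨ht, (1 + I) * v * s, ?_, ?_⟩ ht s (r * e) hso hst ?_
  · intro hU
    exact w_prime.not_isUnit (isUnit_of_mul_isUnit_left (isUnit_of_mul_isUnit_left hU))
  · rw [hy]; ring
  · linear_combination e ^ 2 * hr + u * hN + (s ^ 4 - 2 * I * t ^ 4) * hu2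

/-- The intermediate equation. -/
lemma mid (s t x : GaussianInt) (hs : ¬ (1 + I) ∣ s) (hte : (1 + I) ∣ t) (ht : t ≠ 0)
    (hst : IsCoprime s t)
    (h : x ^ 2 = (s ^ 2 - (1 + I) * t ^ 2) * (s ^ 2 - 2 * (1 + I) * t ^ 2)) : False := by
  obtain ⟨l, hl⟩ := odd_sq2 s hs
  have hcop : IsCoprime (s ^ 2 - (1 + I) * t ^ 2) (s ^ 2 - 2 * (1 + I) * t ^ 2) := by
    have h1 : IsCoprime (s ^ 2) ((1 + I) * t ^ 2) :=
      (((isCoprime_w s hs).symm).mul_right hst.pow_right).pow_left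
    obtain ⟨a, b, hab⟩ := h1
    exact ⟨2 * a + b, -a - b, by linear_combination hab⟩
  obtain ⟨p, u, hp⟩ := exists_associated_pow_of_mul_eq_pow' hcop h.symm
  obtain ⟨t1, ht1⟩ := hte
  have hA : s ^ 2 - (1 + I) * t ^ 2 = 1 + 2 * (l - I * (1 + I) * t1 ^ 2) := by
    rw [ht1]
    linear_combination hl - (1 + I) * t1 ^ 2 * I_sq
  have hpo : ¬ (1 + I) ∣ p := by
    intro hd
    apply odd_of_one _ _ hA
    rw [← hp]
    exact Dvd.dvd.mul_right (dvd_pow hd (by norm_num)) _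
  obtain ⟨k, hk⟩ := odd_sq2 p hpo
  have hu := unit_pm u (p ^ 2) k _ u.isUnit hk (by rw [← hA, ← hp]; ring)
  obtain ⟨r, hr, hru⟩ := pm_sq u hu
  have hP : (r * p) ^ 2 = s ^ 2 - (1 + I) * t ^ 2 := by rw [← hp, ← hr]; ring
  have hPo : ¬ (1 + I) ∣ r * p := fun hd => hpo ((hru.dvd_mul_left).mp hd)
  generalize r * p = P at hP hPo
  have hP0 : P ≠ 0 := by rintro rfl; exact hPo (dvd_zero _)
  have hPx : P ∣ x := by
    refine (IsIntegrallyClosed.pow_dvd_pow_iff (n := 2) (by norm_num)).mp ?_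
    rw [hP, h]
    exact dvd_mul_right _ _
  obtain ⟨q, rfl⟩ := hPx
  have hq : q ^ 2 = s ^ 2 - 2 * (1 + I) * t ^ 2 := by
    apply mul_left_cancel₀ (pow_ne_zero 2 hP0)
    rw [← mul_pow, h, hP]
  refine core t ht P (s * q) hPo ?_ ?_
  · have h1 : IsCoprime (P ^ 2) t := by
      rw [hP]
      have := (hst.pow_left (m := 2)).add_mul_right_left (-(1 + I) * t)
      rwa [show s ^ 2 + -(1 + I) * t * t = s ^ 2 - (1 + I) * t ^ 2 by ring] at this
    exact (IsCoprime.pow_left_iff (by norm_num)).mp h1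
  · rw [show P ^ 4 = (P ^ 2) ^ 2 by ring, hP, mul_pow, hq]
    linear_combination -t ^ 4 * I_sq

lemma coprime_four_I (a : GaussianInt) (h : ¬ (1 + I) ∣ a) : IsCoprime (2 * (2 * I)) a :=
  (coprime_two a h).mul_left
    ((isCoprime_mul_unit_right_left (IsUnit.of_mul_eq_one (-I) (by decide)) _ _).mpr
      (coprime_two a h))

end GaussDescent

open GaussDescent

/-- The equation `x⁴ + 6(1+i)·x²y² + 2i·y⁴ = z²`, with `y` divisible by
`1 + i`, has no nontrivial solutions over the Gaussian integers. -/
theorem no_nontrivial_solution_x4_add_6_one_add_i_x2y2_add_2i_y4_eq_z2 :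
    ¬ ∃ x y z : GaussianInt, x * y * z ≠ 0 ∧
      (∀ d : GaussianInt, d ∣ x → d ∣ y → d ∣ z → IsUnit d) ∧
      (1 + sqrtd) ∣ y ∧
      x ^ 4 + 6 * (1 + sqrtd) * x ^ 2 * y ^ 2 + 2 * sqrtd * y ^ 4 = z ^ 2 := by
  rintro ⟨x, y, z, hne, hgcd, hye, h⟩
  change (1 + I) ∣ y at hye
  change x ^ 4 + 6 * (1 + I) * x ^ 2 * y ^ 2 + 2 * I * y ^ 4 = z ^ 2 at h
  have hy : y ≠ 0 := by rintro rfl; simp at hne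
  have hxy : IsCoprime x y := by
    refine isCoprime_of_prime_dvd (fun h => hy h.2) ?_
    intro d hd hdx hdy
    refine hd.not_isUnit (hgcd d hdx hdy ?_)
    refine hd.dvd_of_dvd_pow (n := 2) ?_
    rw [← h]
    obtain ⟨a, rfl⟩ := hdx
    obtain ⟨b, rfl⟩ := hdy
    exact ⟨d ^ 3 * (a ^ 4 + 6 * (1 + I) * a ^ 2 * b ^ 2 + 2 * I * b ^ 4), by ring⟩
  have hxo : ¬ (1 + I) ∣ x := fun hd => w_prime.not_isUnit (hxy.isUnit_of_dvd' hd hye)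
  obtain ⟨y1, hy1⟩ := hye
  obtain ⟨k4, hk4⟩ := odd_pow4 x hxo
  obtain ⟨l, hl⟩ := odd_sq2 x hxo
  have hy2 : y ^ 2 = 2 * I * y1 ^ 2 := by rw [hy1]; linear_combination y1 ^ 2 * I_sq
  have hz4 : z ^ 2 = 1 + 4 * (k4 + 3 * I * (1 + I) * x ^ 2 * y1 ^ 2 - 2 * I * y1 ^ 4) := by
    rw [← h, show y ^ 4 = (y ^ 2) ^ 2 by ring, hy2]
    linear_combination hk4 + 8 * I * y1 ^ 4 * I_sq
  have hzo : ¬ (1 + I) ∣ z := fun hd =>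
    odd_of_one (z ^ 2) (2 * (k4 + 3 * I * (1 + I) * x ^ 2 * y1 ^ 2 - 2 * I * y1 ^ 4))
      (by rw [hz4]; ring) (dvd_pow hd (by norm_num))
  obtain ⟨k, hk⟩ := root_one z _ hzo hz4
  have hN : x ^ 2 + 3 * (1 + I) * y ^ 2 = 1 + 2 * (l + 3 * (1 + I) * I * y1 ^ 2) := by
    rw [hy2, hl]; ring
  obtain ⟨L, hL⟩ : ∃ L, L = l + 3 * (1 + I) * I * y1 ^ 2 := ⟨_, rfl⟩
  rw [← hL] at hN
  obtain ⟨s, t, u, v, hu, hv, hN', hyv, hso, hst⟩ :=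
    split (L - k) (1 + L + k) (x ^ 2 + 3 * (1 + I) * y ^ 2) (2 * (2 * I)) y L (2 * I) rfl
      coprime_four_I hy (by rw [hN]; ring) hN (by decide) (by
        have := (hxy.pow_left (m := 2)).add_mul_right_left (3 * (1 + I) * y)
        rwa [show x ^ 2 + 3 * (1 + I) * y * y = x ^ 2 + 3 * (1 + I) * y ^ 2 by ring] at this) (by
        apply mul_left_cancel₀ (show (4 : GaussianInt) ≠ 0 by decide)
        have h1 : 4 * ((L - k) * (1 + L + k)) =
            (x ^ 2 + 3 * (1 + I) * y ^ 2 - z) * (x ^ 2 + 3 * (1 + I) * y ^ 2 + z) := by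
          rw [hN, hk]; ring
        rw [h1]
        linear_combination h + 9 * y ^ 4 * I_sq)
  have ht : t ≠ 0 := by rintro rfl; simp at hyv; exact hy hyv
  have hte : (1 + I) ∣ t := by
    have h1 : (1 + I) ∣ v * (s * t) := hyv ▸ ⟨y1, hy1⟩
    have h2 := (hv.dvd_mul_left).mp h1
    exact (w_prime.dvd_or_dvd h2).resolve_left hso
  obtain ⟨r, hr, -⟩ := pm_sq u hu
  have hu2 : u ^ 2 = 1 := by rcases hu with rfl | rfl <;> ring
  have huv : u * v ^ 2 = 1 ∨ u * v ^ 2 = -1 := by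
    rcases hu with rfl | rfl <;> rcases unit_sq v hv with h | h <;> rw [h] <;> simp
  obtain ⟨q, hq, hqu⟩ := pm_sq _ huv
  have hq4 : q ^ 4 = 1 := by
    rw [show q ^ 4 = (q ^ 2) ^ 2 by ring, hq]
    rcases huv with h | h <;> rw [h] <;> ring
  refine mid s (q * t) (r * x) hso (Dvd.dvd.mul_left hte q)
    (mul_ne_zero hqu.ne_zero ht) ((isCoprime_mul_unit_left_right hqu _ _).mpr hst) ?_
  rw [hyv] at hN'
  linear_combination x ^ 2 * hr + u * hN' + (s ^ 4 + 4 * I * t ^ 4) * hu2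
    + 3 * (1 + I) * s ^ 2 * t ^ 2 * hq - 4 * I * t ^ 4 * hq4 - 2 * q ^ 4 * t ^ 4 * I_sq
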